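/- arXiv:1804.09393 — 3 statements merged into one kernel-verified Lean document; each statement's English description precedes it below -/
import Mathlib

section
/- If x is a maximum-cardinality b-matching of (G,b) and x^W is a maximum-cardinality b-matching of (H_W, b^W), then ‖x‖₁ = ‖x^W‖₁ + μ^U(0) − c₂^U. -/
open scoped Classical

/-- The degree of a vertex `v` under an edge-weight assignment `x`:
the sum of the weights of the edges of `G` incident to `v`. -/
noncomputable def bmDeg {V : Type*} [Fintype V] (G : SimpleGraph V)
    (x : Sym2 V → ℕ) (v : V) : ℕ :=
  ∑ e ∈ Finset.univ.filter (fun e : Sym2 V => e ∈ G.edgeSet ∧ v ∈ e), x e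

/-- The cardinality `‖x‖₁` of an edge-weight assignment `x`. -/
noncomputable def bmCard {V : Type*} [Fintype V] (G : SimpleGraph V)
    (x : Sym2 V → ℕ) : ℕ :=
  ∑ e ∈ Finset.univ.filter (fun e : Sym2 V => e ∈ G.edgeSet), x e

/-- `x` is a `b`-matching of `(G, b)`: it is supported on the edges of `G`
and the degree of every vertex `v` is at most `b v`. -/
def IsBMatching {V : Type*} [Fintype V] (G : SimpleGraph V) (b : V → ℕ)
    (x : Sym2 V → ℕ) : Prop :=
  (∀ e, e ∉ G.edgeSet → x e = 0) ∧ ∀ v, bmDeg G x v ≤ b v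

/-- The maximum cardinality of a `b`-matching of `(G, b)`. -/
noncomputable def maxBM {V : Type*} [Fintype V] (G : SimpleGraph V) (b : V → ℕ) : ℕ :=
  sSup {m | ∃ x, IsBMatching G b x ∧ bmCard G x = m}

/-- `mu G b w t` : the maximum cardinality of a `b`-matching of `G` when the
capacity of `w` is set to `t` and every other vertex `v` has capacity `b v`. -/
noncomputable def mu {V : Type*} [Fintype V] (G : SimpleGraph V) (b : V → ℕ)
    (w : V) (t : ℕ) : ℕ :=
  maxBM G (Function.update b w t)


/-- `(U, W)` is a split of `G`: a partition of the vertex set with both sides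
of size at least `2`, such that every vertex of `U` having a neighbour in `W`
is adjacent to every vertex of `W` having a neighbour in `U`. -/
def IsSplit {V : Type*} (G : SimpleGraph V) (U W : Set V) : Prop :=
  U ∪ W = Set.univ ∧ Disjoint U W ∧ 2 ≤ U.ncard ∧ 2 ≤ W.ncard ∧
    ∀ a ∈ U, ∀ c ∈ W, (∃ b' ∈ W, G.Adj a b') → (∃ a' ∈ U, G.Adj a' c) → G.Adj a c

/-- `splitC G U W` is the set of vertices of `U` with a neighbour in `W`
(so `splitC G U W = C = N_G(W)` and `splitC G W U = D = N_G(U)`). -/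
def splitC {V : Type*} (G : SimpleGraph V) (U W : Set V) : Set V :=
  {a | a ∈ U ∧ ∃ c ∈ W, G.Adj a c}

/-- Given a split `(U, W)` (with `C = N_G(W)`), the graph `G_U` on `U ∪ {w}`:
the induced subgraph `G[U]` together with a new split marker vertex `w`
(represented by `none`) adjacent to every vertex of `C`. -/
def sideGraph {V : Type*} (G : SimpleGraph V) (U C : Set V) :
    SimpleGraph (Option ↥U) :=
  SimpleGraph.fromRel (fun a c =>
    match a, c with
    | some a', some c' => G.Adj ↑a' ↑c'
    | some a', none => ↑a' ∈ C
    | _, _ => False)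

/-- `μ^U(t)`: the maximum cardinality of a `b`-matching of `G_U` when the split
marker vertex `w` has capacity `t` and every `v ∈ U` has capacity `b v`. -/
noncomputable def muU {V : Type*} [Fintype V] (G : SimpleGraph V) (b : V → ℕ)
    (U W : Set V) (t : ℕ) : ℕ :=
  mu (sideGraph G U (splitC G U W)) (fun a => a.elim 0 (fun v => b ↑v)) none t

/-- The auxiliary graph `H_W`, obtained from `G_W` by replacing the split marker
vertex `u` with three new vertices `u₁, u₂, u₃` (represented by `Sum.inr 0`,
`Sum.inr 1`, `Sum.inr 2`), each adjacent to every vertex of `D`, together with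
the additional edge `{u₂, u₃}`. -/
def auxGraph {V : Type*} (G : SimpleGraph V) (W D : Set V) :
    SimpleGraph (↥W ⊕ Fin 3) :=
  SimpleGraph.fromRel (fun a c =>
    match a, c with
    | Sum.inl a', Sum.inl c' => G.Adj ↑a' ↑c'
    | Sum.inl a', Sum.inr _ => ↑a' ∈ D
    | Sum.inr i, Sum.inr j => i = 1 ∧ j = 2
    | _, _ => False)

/-- The capacity function `b^W` on `H_W`: `b^W v = b v` for `v ∈ W`,
`b^W u₁ = c₁^U` and `b^W u₂ = b^W u₃ = c₂^U`. -/
def auxB {V : Type*} (W : Set V) (b : V → ℕ) (c₁ c₂ : ℕ) : ↥W ⊕ Fin 3 → ℕ :=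
  Sum.elim (fun a => b ↑a) (fun i => if i = 0 then c₁ else c₂)


theorem bmDeg_eq_sum {A : Type*} [Fintype A] (G : SimpleGraph A) (x : Sym2 A → ℕ)
    (hx : ∀ e, e ∉ G.edgeSet → x e = 0) (v : A) :
    bmDeg G x v = ∑ u, x s(v, u) := by
  unfold bmDeg
  rw [← Finset.sum_filter_add_sum_filter_not Finset.univ (fun u => G.Adj v u)]
  rw [Finset.sum_eq_zero (s := Finset.univ.filter (fun u => ¬ G.Adj v u))]
  · rw [add_zero]
    symm
    apply Finset.sum_bij (fun u _ => s(v, u))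
    · intro u hu
      simpa using hu
    · intro a _ c _ h
      exact Sym2.congr_right.1 h
    · intro e he
      simp only [Finset.mem_filter, Finset.mem_univ, true_and] at he
      obtain ⟨he, u, rfl⟩ := he
      exact ⟨u, by simpa using he, rfl⟩
    · intros; rfl
  · intro u hu
    apply hx
    simpa using hu

theorem sum_bmDeg {A : Type*} [Fintype A] (G : SimpleGraph A) (x : Sym2 A → ℕ) :
    ∑ v, bmDeg G x v = 2 * bmCard G x := by
  unfold bmDeg bmCard
  simp_rw [Finset.sum_filter]
  rw [Finset.sum_comm, Finset.mul_sum]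
  apply Finset.sum_congr rfl
  intro e _
  by_cases he : e ∈ G.edgeSet
  · simp only [he, true_and, if_true]
    rw [← Finset.sum_filter, Finset.sum_const, smul_eq_mul]
    congr 1
    have := Sym2.card_toFinset_of_not_isDiag e (G.not_isDiag_of_mem_edgeSet he)
    rw [← this]
    congr 1
    ext v
    simp
  · simp [he]

theorem exists_of_matrix {A : Type*} [Fintype A] (G : SimpleGraph A) (M : A → A → ℕ)
    (hs : ∀ u v, M u v = M v u) (hM : ∀ u v, M u v ≠ 0 → G.Adj u v) :
    ∃ x : Sym2 A → ℕ, (∀ e, e ∉ G.edgeSet → x e = 0) ∧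
      (∀ v, bmDeg G x v = ∑ u, M v u) ∧ 2 * bmCard G x = ∑ v, ∑ u, M v u := by
  have h0 : ∀ e, e ∉ G.edgeSet → (Sym2.lift ⟨M, hs⟩ : Sym2 A → ℕ) e = 0 := by
    intro e
    induction e using Sym2.ind with
    | _ u v =>
      intro h
      by_contra h1
      exact h (hM u v (by simpa using h1))
  refine ⟨Sym2.lift ⟨M, hs⟩, h0, ?_, ?_⟩
  · intro v
    rw [bmDeg_eq_sum G _ h0]
    simp
  · rw [← sum_bmDeg]
    apply Finset.sum_congr rfl
    intro v _
    rw [bmDeg_eq_sum G _ h0]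
    simp

theorem exists_pred {n : ℕ} {A : Type*} [Fintype A] (r : A → ℕ) (hr : ∑ a, r a = n + 1) :
    ∃ (a : A) (r' : A → ℕ), (∑ a, r' a = n) ∧ ∀ c, r c = r' c + if c = a then 1 else 0 := by
  obtain ⟨a, -, ha⟩ : ∃ a ∈ Finset.univ, r a ≠ 0 := by
    apply Finset.exists_ne_zero_of_sum_ne_zero
    omega
  have h1 : ∀ c, r c = (r c - if c = a then 1 else 0) + if c = a then 1 else 0 := by
    intro c
    split_ifs with h
    · subst h; omega
    · omega
  refine ⟨a, fun c => r c - if c = a then 1 else 0, ?_, h1⟩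
  have h2 : ∑ c, r c = ∑ c, ((r c - if c = a then 1 else 0) + if c = a then 1 else 0) :=
    Finset.sum_congr rfl (fun c _ => h1 c)
  rw [Finset.sum_add_distrib, hr] at h2
  simp at h2
  exact h2.symm

theorem transport {A B : Type*} [Fintype A] [Fintype B] (n : ℕ) :
    ∀ (r : A → ℕ) (s : B → ℕ), ∑ a, r a = n → ∑ c, s c = n →
    ∃ t : A → B → ℕ, (∀ a, ∑ c, t a c = r a) ∧ (∀ c, ∑ a, t a c = s c) := by
  induction n with
  | zero =>
    intro r s hr hs
    refine ⟨fun _ _ => 0, ?_, ?_⟩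
    · intro a
      have := (Finset.sum_eq_zero_iff.1 hr) a (Finset.mem_univ _)
      simp [this]
    · intro a
      have := (Finset.sum_eq_zero_iff.1 hs) a (Finset.mem_univ _)
      simp [this]
  | succ n ih =>
    intro r s hr hs
    obtain ⟨a, r', hr', har⟩ := exists_pred r hr
    obtain ⟨c, s', hs', hcs⟩ := exists_pred s hs
    obtain ⟨t, ht1, ht2⟩ := ih r' s' hr' hs'
    refine ⟨fun i j => t i j + if i = a then (if j = c then 1 else 0) else 0, ?_, ?_⟩
    · intro i
      rw [Finset.sum_add_distrib, ht1, har]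
      split_ifs <;> simp
    · intro j
      rw [Finset.sum_add_distrib, ht2, hcs]
      simp

theorem bmDeg_update {A : Type*} [Fintype A] (G : SimpleGraph A) (x x' : Sym2 A → ℕ)
    (a c : A) (he : s(a, c) ∈ G.edgeSet)
    (hx : ∀ f, x' f = x f + if f = s(a, c) then 1 else 0) (v : A) :
    bmDeg G x' v = bmDeg G x v + (if v = a then 1 else 0) + if v = c then 1 else 0 := by
  have hne : a ≠ c := G.ne_of_adj he
  unfold bmDeg
  simp_rw [hx]
  rw [Finset.sum_add_distrib, add_assoc]
  congr 1
  rw [Finset.sum_ite_eq']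
  by_cases h1 : v = a
  · have : v ≠ c := h1 ▸ hne
    simp_all
  · by_cases h2 : v = c <;> simp_all

/-- exchange property of degree sequences -/
theorem exc {A : Type*} [Fintype A] (G : SimpleGraph A) (y : Sym2 A → ℕ)
    (p : A → ℕ) (i : A) (hi : p i < bmDeg G y i) (n : ℕ) :
    ∀ (x : Sym2 A → ℕ) (k : A), (∀ e, e ∉ G.edgeSet → x e = 0) →
    (∑ e, ((x e : ℤ) - y e).natAbs ≤ n) →
    (∀ v, bmDeg G x v + (if v = k then 1 else 0) = p v + if v = i then 1 else 0) →
    (p k ≤ bmDeg G y k) →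
    ∃ (x' : Sym2 A → ℕ) (j : A), (∀ e, e ∉ G.edgeSet → x' e = 0) ∧
      (((∀ v, bmDeg G x' v = p v + (if v = i then 1 else 0) + if v = j then 1 else 0) ∧
        bmDeg G x' j ≤ bmDeg G y j) ∨
       ((∀ v, bmDeg G x' v + (if v = j then 1 else 0) = p v + if v = i then 1 else 0) ∧
        bmDeg G y j < p j)) := by
  induction n using Nat.strong_induction_on with
  | _ n ih =>
  intro x k hx hd hdeg hk
  have hlt : bmDeg G x k < bmDeg G y k := by
    have := hdeg k
    by_cases h : k = i
    · subst h; simp at this; omega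
    · simp [h] at this; omega
  obtain ⟨e, he, hxe⟩ : ∃ e ∈ Finset.univ.filter (fun e : Sym2 A => e ∈ G.edgeSet ∧ k ∈ e),
      x e < y e := Finset.exists_lt_of_sum_lt hlt
  simp only [Finset.mem_filter, Finset.mem_univ, true_and] at he
  obtain ⟨he, j, rfl⟩ := he
  have hkj : k ≠ j := G.ne_of_adj he
  set x1 : Sym2 A → ℕ := fun f => x f + if f = s(k, j) then 1 else 0 with hx1
  have hd1 : ∀ v, bmDeg G x1 v = p v + (if v = i then 1 else 0) + if v = j then 1 else 0 := by
    intro v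
    rw [bmDeg_update G x x1 _ _ he (fun f => rfl) v]
    have := hdeg v
    omega
  have hx1s : ∀ e, e ∉ G.edgeSet → x1 e = 0 := by
    intro f hf
    have : f ≠ s(k, j) := fun h => hf (h ▸ he)
    simp [hx1, hx f hf, this]
  by_cases hj : bmDeg G x1 j ≤ bmDeg G y j
  · exact ⟨x1, j, hx1s, Or.inl ⟨hd1, hj⟩⟩
  push Not at hj
  obtain ⟨e', he', hxe'⟩ : ∃ e ∈ Finset.univ.filter (fun e : Sym2 A => e ∈ G.edgeSet ∧ j ∈ e),
      y e < x1 e := Finset.exists_lt_of_sum_lt hj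
  simp only [Finset.mem_filter, Finset.mem_univ, true_and] at he'
  obtain ⟨he', k', rfl⟩ := he'
  have hjk : j ≠ k' := G.ne_of_adj he'
  set x2 : Sym2 A → ℕ := fun f => x1 f - if f = s(j, k') then 1 else 0 with hx2
  have hx21 : ∀ f, x1 f = x2 f + if f = s(j, k') then 1 else 0 := by
    intro f
    simp only [hx2]
    by_cases h : f = s(j, k')
    · subst h; simp only [if_true]; omega
    · simp [h]
  have hd2 : ∀ v, bmDeg G x2 v + (if v = k' then 1 else 0) = p v + if v = i then 1 else 0 := by
    intro v
    have h1 := bmDeg_update G x2 x1 _ _ he' hx21 v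
    have := hd1 v
    omega
  have hx2s : ∀ e, e ∉ G.edgeSet → x2 e = 0 := by
    intro f hf
    simp [hx2, hx1s f hf]
  by_cases hk' : bmDeg G y k' < p k'
  · exact ⟨x2, k', hx2s, Or.inr ⟨hd2, hk'⟩⟩
  push Not at hk'
  have hdist : ∑ e, ((x2 e : ℤ) - y e).natAbs < ∑ e, ((x e : ℤ) - y e).natAbs := by
    apply Finset.sum_lt_sum
    · intro f _
      have h1 := hx21 f
      have h2 : x1 f = x f + if f = s(k, j) then 1 else 0 := rfl
      have h3 : f = s(k, j) → x f < y f := by rintro rfl; exact hxe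
      have h4 : f = s(j, k') → y f < x1 f := by rintro rfl; exact hxe'
      split_ifs at h1 h2 with h5 h6 h6
      · have := h3 h6
        have := h4 h5
        omega
      · have := h4 h5
        omega
      · have := h3 (by assumption)
        omega
      · omega
    · refine ⟨s(k, j), Finset.mem_univ _, ?_⟩
      have h1 := hx21 s(k, j)
      have h2 : x1 s(k, j) = x s(k, j) + if s(k, j) = s(k, j) then 1 else 0 := rfl
      rw [if_pos rfl] at h2
      by_cases h4 : s(k, j) = s(j, k')
      · rw [← h4] at hxe'; omega
      · rw [if_neg h4] at h1; omega
  exact ih _ (lt_of_lt_of_le hdist hd) x2 k' hx2s le_rfl hd2 hk'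

theorem maxBM_spec {A : Type*} [Fintype A] (G : SimpleGraph A) (b : A → ℕ) :
    (∃ x, IsBMatching G b x ∧ bmCard G x = maxBM G b) ∧
    ∀ x, IsBMatching G b x → bmCard G x ≤ maxBM G b := by
  have hb : BddAbove {m | ∃ x, IsBMatching G b x ∧ bmCard G x = m} := by
    refine ⟨∑ v, b v, ?_⟩
    rintro m ⟨x, hx, rfl⟩
    have h1 := sum_bmDeg G x
    have h2 : ∑ v, bmDeg G x v ≤ ∑ v, b v := Finset.sum_le_sum (fun v _ => hx.2 v)
    omega
  have hne : {m | ∃ x, IsBMatching G b x ∧ bmCard G x = m}.Nonempty := by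
    refine ⟨_, fun _ => 0, ⟨fun _ _ => rfl, fun v => ?_⟩, rfl⟩
    simp [bmDeg]
  exact ⟨Nat.sSup_mem hne hb, fun x hx => le_csSup hb ⟨x, hx, rfl⟩⟩

/-- degree sequences of matchings with capacity `t` at `w` -/
def DF {A : Type*} [Fintype A] (G : SimpleGraph A) (b : A → ℕ) (w : A) (t : ℕ)
    (p : A → ℕ) : Prop :=
  (∃ x : Sym2 A → ℕ, (∀ e, e ∉ G.edgeSet → x e = 0) ∧ ∀ v, bmDeg G x v = p v) ∧
  (∀ v, v ≠ w → p v ≤ b v) ∧ p w ≤ t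

theorem mu_spec {A : Type*} [Fintype A] (G : SimpleGraph A) (b : A → ℕ) (w : A) (t : ℕ) :
    (∃ p, DF G b w t p ∧ ∑ v, p v = 2 * mu G b w t) ∧
    ∀ p, DF G b w t p → ∑ v, p v ≤ 2 * mu G b w t := by
  obtain ⟨⟨x, hx, hxc⟩, hmax⟩ := maxBM_spec G (Function.update b w t)
  constructor
  · refine ⟨bmDeg G x, ⟨⟨x, hx.1, fun _ => rfl⟩, ?_, ?_⟩, ?_⟩
    · intro v hv
      have := hx.2 v
      rwa [Function.update_of_ne hv] at this
    · have := hx.2 w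
      rwa [Function.update_self] at this
    · rw [sum_bmDeg, hxc]; rfl
  · rintro p ⟨⟨x, hx, hp⟩, hb, hw⟩
    have := hmax x ⟨hx, fun v => by
      rw [hp]
      by_cases h : v = w
      · subst h; simpa using hw
      · rw [Function.update_of_ne h]; exact hb v h⟩
    have h2 := sum_bmDeg G x
    simp_rw [hp] at h2
    rw [h2]
    exact Nat.mul_le_mul_left 2 this

theorem exc2 {A : Type*} [Fintype A] {G : SimpleGraph A} {b : A → ℕ} {w : A} {t T : ℕ}
    {p q : A → ℕ} (hp : DF G b w t p) (hq : DF G b w T q) (i : A) (hi : p i < q i) :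
    ∃ (p' : A → ℕ) (j : A),
      (∃ x : Sym2 A → ℕ, (∀ e, e ∉ G.edgeSet → x e = 0) ∧ ∀ v, bmDeg G x v = p' v) ∧
      (((∀ v, p' v = p v + (if v = i then 1 else 0) + if v = j then 1 else 0) ∧
        p' j ≤ q j ∧ ∑ v, p' v = ∑ v, p v + 2) ∨
       ((∀ v, p' v + (if v = j then 1 else 0) = p v + if v = i then 1 else 0) ∧
        q j < p j ∧ ∑ v, p' v = ∑ v, p v)) := by
  obtain ⟨⟨x, hx, hxp⟩, -⟩ := hp
  obtain ⟨⟨y, hy, hyq⟩, -⟩ := hq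
  obtain ⟨x', j, hx', h⟩ := exc G y p i (by rw [hyq]; exact hi) _ x i hx le_rfl
    (fun v => by rw [hxp]) (by rw [hyq]; exact hi.le)
  refine ⟨bmDeg G x', j, ⟨x', hx', fun _ => rfl⟩, ?_⟩
  rcases h with ⟨h1, h2⟩ | ⟨h1, h2⟩
  · left
    refine ⟨h1, by rwa [hyq] at h2, ?_⟩
    simp_rw [h1, Finset.sum_add_distrib]
    simp
  · right
    refine ⟨h1, by rwa [hyq] at h2, ?_⟩
    have : ∑ v, (bmDeg G x' v + (if v = j then 1 else 0)) = ∑ v, (p v + if v = i then 1 else 0) :=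
      Finset.sum_congr rfl (fun v _ => h1 v)
    simp_rw [Finset.sum_add_distrib] at this
    simpa using this

theorem core {A : Type*} [Fintype A] (G : SimpleGraph A) (b : A → ℕ) (w : A) (t S : ℕ)
    (htS : t ≤ S) (h1 : mu G b w (t + 1) = mu G b w t) (h2 : mu G b w S < mu G b w (S + 1))
    (n : ℕ) :
    ∀ p q : A → ℕ, DF G b w t p → DF G b w (S + 1) q → ∑ v, p v = 2 * mu G b w t →
      ∑ v, q v = 2 * mu G b w (S + 1) → ∑ v, ((p v : ℤ) - q v).natAbs ≤ n →
    ∃ p q : A → ℕ, DF G b w t p ∧ DF G b w (S + 1) q ∧ ∑ v, p v = 2 * mu G b w t ∧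
      ∑ v, q v = 2 * mu G b w (S + 1) ∧ ∀ v, v ≠ w → p v = q v := by
  induction n using Nat.strong_induction_on with
  | _ n ih =>
  intro p q hp hq hps hqs hd
  by_cases ha : ∃ i, i ≠ w ∧ p i < q i
  · obtain ⟨i, hiw, hi⟩ := ha
    obtain ⟨p', j, hx, ⟨e1, e2, e3⟩ | ⟨e1, e2, e3⟩⟩ := exc2 hp hq i hi
    · exfalso
      have : DF G b w (t + 1) p' := by
        refine ⟨hx, ?_, ?_⟩
        · intro v hv
          have a1 := hp.2.1 v hv
          have a2 := hq.2.1 v hv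
          have a3 := e1 v
          by_cases hvj : v = j
          · subst hvj; omega
          · by_cases hvi : v = i
            · subst hvi; simp [hvj] at a3; omega
            · simp [hvj, hvi] at a3; omega
        · have a3 := e1 w
          have := hp.2.2
          rw [if_neg (Ne.symm hiw)] at a3
          split_ifs at a3 <;> omega
      have := (mu_spec G b w (t + 1)).2 p' this
      omega
    · have hji : j ≠ i := by rintro rfl; omega
      have hp' : DF G b w t p' := by
        refine ⟨hx, ?_, ?_⟩
        · intro v hv
          have a1 := hp.2.1 v hv
          have a2 := hq.2.1 v hv
          have a3 := e1 v
          by_cases hvi : v = i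
          · subst hvi; simp [hji.symm] at a3; omega
          · simp [hvi] at a3; omega
        · have a3 := e1 w
          have := hp.2.2
          rw [if_neg (Ne.symm hiw)] at a3
          split_ifs at a3 <;> omega
      have hdist : ∑ v, ((p' v : ℤ) - q v).natAbs < ∑ v, ((p v : ℤ) - q v).natAbs := by
        apply Finset.sum_lt_sum
        · intro v _
          have a3 := e1 v
          by_cases hvi : v = i
          · subst hvi; simp [hji.symm] at a3; omega
          · by_cases hvj : v = j
            · subst hvj; simp [hvi] at a3; omega
            · simp [hvi, hvj] at a3; omega
        · refine ⟨i, Finset.mem_univ _, ?_⟩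
          have a3 := e1 i
          simp [hji.symm] at a3; omega
      exact ih _ (lt_of_lt_of_le hdist hd) p' q hp' hq (e3.trans hps) hqs le_rfl
  push Not at ha
  by_cases hb : ∃ i, i ≠ w ∧ q i < p i
  · exfalso
    obtain ⟨i, hiw, hi⟩ := hb
    obtain ⟨q', j, hx, ⟨e1, e2, e3⟩ | ⟨e1, e2, e3⟩⟩ := exc2 hq hp i hi
    · have : DF G b w (S + 1) q' := by
        refine ⟨hx, ?_, ?_⟩
        · intro v hv
          have a1 := hp.2.1 v hv
          have a2 := hq.2.1 v hv
          have a3 := e1 v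
          by_cases hvj : v = j
          · subst hvj; omega
          · by_cases hvi : v = i
            · subst hvi; simp [hvj] at a3; omega
            · simp [hvj, hvi] at a3; omega
        · have a3 := e1 w
          have := hq.2.2
          have := hp.2.2
          rw [if_neg (Ne.symm hiw)] at a3
          by_cases hwj : w = j
          · subst hwj; omega
          · rw [if_neg hwj] at a3; omega
      have := (mu_spec G b w (S + 1)).2 q' this
      omega
    · have hjw : j = w := by
        by_contra h
        have := ha j h
        omega
      subst hjw
      have : DF G b j S q' := by
        refine ⟨hx, ?_, ?_⟩
        · intro v hv
          have a1 := hp.2.1 v hv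
          have a2 := hq.2.1 v hv
          have a3 := e1 v
          by_cases hvi : v = i
          · subst hvi; simp [hv] at a3; omega
          · simp [hvi, hv] at a3; omega
        · have a3 := e1 j
          have := hq.2.2
          rw [if_neg (Ne.symm hiw), if_pos rfl] at a3
          omega
      have := (mu_spec G b j S).2 q' this
      omega
  push Not at hb
  exact ⟨p, q, hp, hq, hps, hqs, fun v hv => le_antisymm (hb v hv) (ha v hv)⟩

theorem core' {A : Type*} [Fintype A] (G : SimpleGraph A) (b : A → ℕ) (w : A) (t S : ℕ)
    (htS : t ≤ S) (h1 : mu G b w (t + 1) = mu G b w t) (h2 : mu G b w S < mu G b w (S + 1)) :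
    ∃ p q : A → ℕ, DF G b w t p ∧ DF G b w (S + 1) q ∧ ∑ v, p v = 2 * mu G b w t ∧
      ∑ v, q v = 2 * mu G b w (S + 1) ∧ (∀ v, v ≠ w → p v = q v) ∧
      p w + 2 * mu G b w (S + 1) = q w + 2 * mu G b w t := by
  obtain ⟨⟨p, hp, hps⟩, -⟩ := mu_spec G b w t
  obtain ⟨⟨q, hq, hqs⟩, -⟩ := mu_spec G b w (S + 1)
  obtain ⟨p, q, hp, hq, hps, hqs, h⟩ := core G b w t S htS h1 h2 _ p q hp hq hps hqs le_rfl
  refine ⟨p, q, hp, hq, hps, hqs, h, ?_⟩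
  rw [← Finset.add_sum_erase _ _ (Finset.mem_univ w)] at hps hqs
  have : ∑ v ∈ Finset.univ.erase w, p v = ∑ v ∈ Finset.univ.erase w, q v :=
    Finset.sum_congr rfl (fun v hv => h v (Finset.ne_of_mem_erase hv))
  omega

theorem mu_mono {A : Type*} [Fintype A] (G : SimpleGraph A) (b : A → ℕ) (w : A) :
    Monotone (mu G b w) := by
  intro s t hst
  obtain ⟨⟨p, hp, hps⟩, -⟩ := mu_spec G b w s
  have := (mu_spec G b w t).2 p ⟨hp.1, hp.2.1, hp.2.2.trans hst⟩
  omega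

theorem mu_B {A : Type*} [Fintype A] (G : SimpleGraph A) (b : A → ℕ) (w : A)
    (hstep : ∀ t, mu G b w (t + 1) ≤ mu G b w t + 1) (t T : ℕ)
    (hT : mu G b w t < mu G b w T) : mu G b w t < mu G b w (t + 2) := by
  by_contra hcon
  push Not at hcon
  have hm := mu_mono G b w
  have hex : ∃ T, mu G b w t < mu G b w T := ⟨T, hT⟩
  have h1 := Nat.find_spec hex
  have hmin := fun {m} => Nat.find_min hex (m := m)
  set T' := Nat.find hex with hT'
  have hgt : t + 2 < T' := by
    by_contra h
    have := hm (not_lt.1 h)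
    omega
  obtain ⟨S, hS⟩ : ∃ S, T' = S + 1 := ⟨T' - 1, by omega⟩
  have h3 := hmin (m := S) (by omega)
  rw [hS] at h1
  have h4 := hm (show t ≤ t + 1 by omega)
  have h5 := hm (show t + 1 ≤ t + 2 by omega)
  obtain ⟨p, q, hp, hq, hps, hqs, h, hw⟩ := core' G b w t S (by omega) (by omega) (by omega)
  have h6 := hp.2.2
  have h7 := hstep S
  have := (mu_spec G b w (t + 2)).2 q ⟨hq.1, hq.2.1, by omega⟩
  omega

theorem mu_A {A : Type*} [Fintype A] (G : SimpleGraph A) (b : A → ℕ) (w : A)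
    (hstep : ∀ t, mu G b w (t + 1) ≤ mu G b w t + 1) (t : ℕ)
    (ht : mu G b w (t + 1) = mu G b w t) : mu G b w (t + 3) ≤ mu G b w t + 1 := by
  by_contra hcon
  push Not at hcon
  have h1 : mu G b w (t + 2) ≤ mu G b w (t + 1) + 1 := hstep (t + 1)
  have h2 : mu G b w (t + 3) ≤ mu G b w (t + 2) + 1 := hstep (t + 2)
  obtain ⟨p, q, hp, hq, hps, hqs, h, hw⟩ := core' G b w t (t + 2) (by omega) ht
    (show mu G b w (t + 2) < mu G b w (t + 3) by omega)
  have h3 : mu G b w (t + 2 + 1) = mu G b w t + 2 := by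
    change mu G b w (t + 3) = _
    omega
  have h6 := hq.2.2
  obtain ⟨p', j, hx, ⟨e1, e2, e3⟩ | ⟨e1, e2, e3⟩⟩ := exc2 hp hq w (by omega)
  · have hjw : j = w := by
      by_contra hj
      have := h j hj
      have := e1 j
      simp [hj] at this
      omega
    subst hjw
    have := (mu_spec G b j (t + 1)).2 p' ⟨hx, fun v hv => by
      have := hp.2.1 v hv
      have := e1 v
      simp [hv] at this
      omega, by
      have := e1 j
      simp at this
      omega⟩
    omega
  · by_cases hj : j = w
    · subst hj; omega
    · have := h j hj
      omega

theorem pattern (f : ℕ → ℕ) (hm : Monotone f) (hstep : ∀ t, f (t + 1) ≤ f t + 1)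
    (hA : ∀ t, f (t + 1) = f t → f (t + 3) ≤ f t + 1)
    (hB : ∀ t T, f t < f T → f t < f (t + 2))
    (tmax c₁ c₂ : ℕ)
    (htmax : ∀ t : ℕ, tmax ≤ t → f t = f tmax)
    (htmax_least : ∀ t₀ : ℕ, (∀ t : ℕ, t₀ ≤ t → f t = f t₀) → tmax ≤ t₀)
    (hc₁ : f c₁ = f 0 + c₁)
    (hc₁_max : ∀ t : ℕ, f t = f 0 + t → t ≤ c₁)
    (hc₂ : c₂ = (tmax - c₁) / 2) :
    tmax = c₁ + 2 * c₂ ∧ (∀ k, k ≤ c₁ → f k = f 0 + k) ∧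
    ∀ j, j ≤ 2 * c₂ → f (c₁ + j) = f 0 + c₁ + j / 2 := by
  have hle : ∀ s d, f (s + d) ≤ f s + d := by
    intro s d
    induction d with
    | zero => simp
    | succ d ih =>
      have := hstep (s + d)
      rw [← add_assoc]
      omega
  have hbase : f (c₁ + 1) = f c₁ := by
    have h1 := hstep c₁
    have h2 := hm (show c₁ ≤ c₁ + 1 by omega)
    by_contra h
    have := hc₁_max (c₁ + 1) (by omega)
    omega
  have hconst : ∀ t, f (t + 2) = f t → tmax ≤ t := by
    intro t ht
    apply htmax_least
    intro T hT
    have h1 := hm hT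
    by_contra h
    have := hB t T (by omega)
    omega
  have hcle : c₁ ≤ tmax := by
    by_contra h
    have h1 := htmax c₁ (by omega)
    have h2 := hle 0 tmax
    rw [zero_add] at h2
    omega
  have hind : ∀ n, c₁ + 2 * n ≤ tmax → f (c₁ + 2 * n) = f 0 + c₁ + n ∧
      f (c₁ + 2 * n + 1) = f 0 + c₁ + n := by
    intro n
    induction n with
    | zero => intro _; exact ⟨by simpa using hc₁, by simpa [hbase] using hc₁⟩
    | succ n ih =>
      intro hn
      obtain ⟨i1, i2⟩ := ih (by omega)
      have h1 : f (c₁ + 2 * n + 2) ≠ f (c₁ + 2 * n) := by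
        intro h
        have := hconst _ h
        omega
      have h2 := hm (show c₁ + 2 * n ≤ c₁ + 2 * n + 2 by omega)
      have h3 := hstep (c₁ + 2 * n + 1)
      have h4 := hA (c₁ + 2 * n) (by omega)
      have h5 := hm (show c₁ + 2 * n + 2 ≤ c₁ + 2 * n + 3 by omega)
      have e1 : c₁ + 2 * n + 1 + 1 = c₁ + 2 * n + 2 := by omega
      have e2 : c₁ + 2 * (n + 1) = c₁ + 2 * n + 2 := by omega
      have e3 : c₁ + 2 * n + 2 + 1 = c₁ + 2 * n + 3 := by omega
      rw [e1] at h3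
      rw [e2, e3]
      omega
  have heven : tmax = c₁ + 2 * c₂ := by
    by_contra h
    have h0 : tmax = c₁ + 2 * c₂ + 1 := by omega
    obtain ⟨i1, i2⟩ := hind c₂ (by omega)
    have := hconst (c₁ + 2 * c₂) (by
      rw [htmax _ (by omega), h0, i1, i2])
    omega
  refine ⟨heven, ?_, ?_⟩
  · intro k hk
    have h1 := hle 0 k
    have h2 := hle k (c₁ - k)
    rw [zero_add] at h1
    rw [Nat.add_sub_cancel' hk] at h2
    omega
  · intro j hj
    obtain ⟨i1, i2⟩ := hind (j / 2) (by omega)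
    rcases Nat.even_or_odd' j with ⟨n, rfl | rfl⟩
    · rw [show 2 * n / 2 = n by omega] at *; exact i1
    · rw [show (2 * n + 1) / 2 = n by omega] at *; exact i2

/-- one side of the split: internal weight `I`, weight `k` going to the marker -/
def HP {A : Type*} [Fintype A] (R : A → A → Prop) (C : A → Prop) (b : A → ℕ) (I k : ℕ) : Prop :=
  ∃ (m : A → A → ℕ) (r : A → ℕ), (∀ u v, m u v = m v u) ∧ (∀ u v, m u v ≠ 0 → R u v) ∧
    (∀ v, r v ≠ 0 → C v) ∧ (∀ v, ∑ u, m v u + r v ≤ b v) ∧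
    ∑ v, ∑ u, m v u = 2 * I ∧ ∑ v, r v = k

theorem HP.mono {A : Type*} [Fintype A] {R : A → A → Prop} {C : A → Prop} {b : A → ℕ}
    {I k k' : ℕ} (h : HP R C b I k) (hk : k' ≤ k) : HP R C b I k' := by
  obtain ⟨m, r, h1, h2, h3, h4, h5, h6⟩ := h
  obtain ⟨t, ht1, ht2⟩ := transport k r ![k', k - k'] h6 (by simp; omega)
  have hle : ∀ v, t v 0 ≤ r v := by
    intro v
    rw [← ht1 v]
    simp
  refine ⟨m, fun v => t v 0, h1, h2, ?_, ?_, h5, ?_⟩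
  · intro v hv
    apply h3
    have := hle v
    simp only at hv
    omega
  · intro v
    have := hle v
    have := h4 v
    show _ + t v 0 ≤ _
    omega
  · simpa using ht2 0

theorem even_matrix {A : Type*} [Fintype A] (m : A → A → ℕ) (hs : ∀ u v, m u v = m v u)
    (h : ∀ u v, m u v ≠ 0 → u ≠ v) : ∃ I, ∑ v, ∑ u, m v u = 2 * I := by
  obtain ⟨x, -, -, hx⟩ := exists_of_matrix (⊤ : SimpleGraph A) m hs (by simpa using h)
  exact ⟨_, hx.symm⟩

section side
variable {V : Type*} (G : SimpleGraph V) (U C : Set V)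

theorem side_some (u v : U) : (sideGraph G U C).Adj (some u) (some v) ↔ G.Adj u v := by
  simp only [sideGraph, SimpleGraph.fromRel_adj, ne_eq, Option.some.injEq]
  constructor
  · rintro ⟨-, h | h⟩
    · exact h
    · exact h.symm
  · intro h
    exact ⟨fun e => G.ne_of_adj h (by rw [e]), Or.inl h⟩

theorem side_none (u : U) : (sideGraph G U C).Adj (some u) none ↔ (u : V) ∈ C := by
  simp [sideGraph, SimpleGraph.fromRel_adj]

theorem side_to [Fintype V] (b : V → ℕ) (t : ℕ) (B : Option U → ℕ) (hB0 : B none = t)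
    (hB : ∀ u : U, B (some u) = b u) (x : Sym2 (Option U) → ℕ)
    (hx : IsBMatching (sideGraph G U C) B x) :
    ∃ I k, k ≤ t ∧ HP (fun u v : U => G.Adj u v) (fun u => (u : V) ∈ C) (fun u => b u) I k ∧
      bmCard (sideGraph G U C) x = I + k := by
  obtain ⟨hs, hd⟩ := hx
  have hR : ∀ u v : U, x s(some u, some v) ≠ 0 → G.Adj u v := by
    intro u v h
    rw [← side_some G U C]
    by_contra h1
    exact h (hs _ h1)
  obtain ⟨I, hI⟩ := even_matrix (fun u v : U => x s(some u, some v))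
    (fun u v => by rw [Sym2.eq_swap]) (fun u v h e => G.ne_of_adj (hR u v h) (by rw [e]))
  have h00 : x s(none, none) = 0 := hs _ (by simp)
  have hsw : ∀ u : U, x s(none, some u) = x s(some u, none) := fun u => by rw [Sym2.eq_swap]
  have hsum := sum_bmDeg (sideGraph G U C) x
  simp_rw [bmDeg_eq_sum _ x hs, Fintype.sum_option, h00, hsw, Finset.sum_add_distrib] at hsum
  have hdn := hd none
  rw [bmDeg_eq_sum _ x hs, Fintype.sum_option, hB0] at hdn
  simp_rw [h00, hsw] at hdn
  refine ⟨I, ∑ u : U, x s(some u, none), by omega, ⟨fun u v => x s(some u, some v),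
    fun u => x s(some u, none), fun u v => congrArg x Sym2.eq_swap, hR, ?_, ?_, hI, rfl⟩, ?_⟩
  · intro u h
    rw [← side_none G U C]
    by_contra h1
    exact h (hs _ h1)
  · intro u
    have := hd (some u)
    rw [bmDeg_eq_sum _ x hs, Fintype.sum_option, hB] at this
    show ∑ v : U, x s(some u, some v) + x s(some u, none) ≤ b u
    omega
  · omega

theorem side_from [Fintype V] (b : V → ℕ) (t I k : ℕ) (hk : k ≤ t) (B : Option U → ℕ)
    (hB0 : B none = t) (hB : ∀ u : U, B (some u) = b u)
    (h : HP (fun u v : U => G.Adj u v) (fun u => (u : V) ∈ C) (fun u => b u) I k) :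
    ∃ x : Sym2 (Option U) → ℕ, IsBMatching (sideGraph G U C) B x ∧
      bmCard (sideGraph G U C) x = I + k := by
  obtain ⟨m, r, h1, h2, h3, h4, h5, h6⟩ := h
  obtain ⟨x, hx, hd, hc⟩ := exists_of_matrix (sideGraph G U C)
    (fun a c => match a, c with
      | some u, some v => m u v
      | some u, none => r u
      | none, some u => r u
      | none, none => 0)
    (by rintro (_ | u) (_ | v) <;> simp [h1])
    (by
      rintro (_ | u) (_ | v) <;> intro h
      · simp at h
      · exact ((side_none G U C v).2 (h3 v h)).symm
      · exact (side_none G U C u).2 (h3 u h)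
      · exact (side_some G U C u v).2 (h2 u v h))
  refine ⟨x, ⟨hx, ?_⟩, ?_⟩
  · rintro (_ | u)
    · rw [hd, hB0, Fintype.sum_option]
      simp only
      omega
    · rw [hd, hB, Fintype.sum_option]
      have : ∑ v : U, m u v + r u ≤ b u := h4 u
      simp only
      omega
  · simp_rw [Fintype.sum_option, Finset.sum_add_distrib] at hc
    omega

theorem aux_ll (u v : U) : (auxGraph G U C).Adj (Sum.inl u) (Sum.inl v) ↔ G.Adj u v := by
  simp only [auxGraph, SimpleGraph.fromRel_adj, ne_eq, Sum.inl.injEq]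
  constructor
  · rintro ⟨-, h | h⟩
    · exact h
    · exact h.symm
  · intro h
    exact ⟨fun e => G.ne_of_adj h (by rw [e]), Or.inl h⟩

theorem aux_lr (u : U) (i : Fin 3) :
    (auxGraph G U C).Adj (Sum.inl u) (Sum.inr i) ↔ (u : V) ∈ C := by
  simp [auxGraph, SimpleGraph.fromRel_adj]

theorem aux_rr (i j : Fin 3) :
    (auxGraph G U C).Adj (Sum.inr i) (Sum.inr j) ↔ (i = 1 ∧ j = 2) ∨ (i = 2 ∧ j = 1) := by
  simp only [auxGraph, SimpleGraph.fromRel_adj, ne_eq, Sum.inr.injEq]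
  constructor
  · rintro ⟨-, h | h⟩
    · exact Or.inl h
    · exact Or.inr ⟨h.2, h.1⟩
  · rintro (⟨rfl, rfl⟩ | ⟨rfl, rfl⟩)
    · exact ⟨by decide, Or.inl ⟨rfl, rfl⟩⟩
    · exact ⟨by decide, Or.inr ⟨rfl, rfl⟩⟩

theorem aux_to [Fintype V] (b : V → ℕ) (c₁ c₂ : ℕ) (x : Sym2 (U ⊕ Fin 3) → ℕ)
    (hx : IsBMatching (auxGraph G U C) (auxB U b c₁ c₂) x) :
    ∃ I a₀ a₁ a₂ e, a₀ ≤ c₁ ∧ a₁ + e ≤ c₂ ∧ a₂ + e ≤ c₂ ∧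
      HP (fun u v : U => G.Adj u v) (fun u => (u : V) ∈ C) (fun u => b u) I (a₀ + a₁ + a₂) ∧
      bmCard (auxGraph G U C) x = I + (a₀ + a₁ + a₂) + e := by
  obtain ⟨hs, hd⟩ := hx
  have hR : ∀ u v : U, x s(Sum.inl u, Sum.inl v) ≠ 0 → G.Adj u v := by
    intro u v h
    rw [← aux_ll G U C]
    by_contra h1
    exact h (hs _ h1)
  have hC : ∀ (u : U) (i : Fin 3), x s(Sum.inl u, Sum.inr i) ≠ 0 → (u : V) ∈ C := by
    intro u i h
    rw [← aux_lr G U C u i]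
    by_contra h1
    exact h (hs _ h1)
  obtain ⟨I, hI⟩ := even_matrix (fun u v : U => x s(Sum.inl u, Sum.inl v))
    (fun u v => by rw [Sym2.eq_swap]) (fun u v h e => G.ne_of_adj (hR u v h) (by rw [e]))
  have h0 : ∀ i j : Fin 3, ¬ ((i = 1 ∧ j = 2) ∨ (i = 2 ∧ j = 1)) →
      x s(Sum.inr i, Sum.inr j) = 0 := by
    intro i j h
    apply hs
    intro h1
    exact h ((aux_rr G U C i j).1 h1)
  have h00 := h0 0 0 (by decide)
  have h01 := h0 0 1 (by decide)
  have h02 := h0 0 2 (by decide)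
  have h10 := h0 1 0 (by decide)
  have h11 := h0 1 1 (by decide)
  have h20 := h0 2 0 (by decide)
  have h22 := h0 2 2 (by decide)
  have h21 : x s(Sum.inr 2, Sum.inr 1) = x s(Sum.inr 1, Sum.inr 2) := by rw [Sym2.eq_swap]
  have hsw : ∀ (u : U) (i : Fin 3), x s(Sum.inr i, Sum.inl u) = x s(Sum.inl u, Sum.inr i) :=
    fun u i => by rw [Sym2.eq_swap]
  have hsum := sum_bmDeg (auxGraph G U C) x
  simp_rw [bmDeg_eq_sum _ x hs, Fintype.sum_sum_type, Fin.sum_univ_three, h00, h01, h02, h10,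
    h11, h20, h22, h21, hsw, Finset.sum_add_distrib] at hsum
  have hd0 := hd (Sum.inr 0)
  have hd1 := hd (Sum.inr 1)
  have hd2 := hd (Sum.inr 2)
  simp_rw [bmDeg_eq_sum _ x hs, Fintype.sum_sum_type, Fin.sum_univ_three, h00, h01, h02, hsw]
    at hd0
  simp_rw [bmDeg_eq_sum _ x hs, Fintype.sum_sum_type, Fin.sum_univ_three, h10, h11, hsw]
    at hd1
  simp_rw [bmDeg_eq_sum _ x hs, Fintype.sum_sum_type, Fin.sum_univ_three, h20, h21, h22, hsw]
    at hd2
  simp [auxB] at hd0 hd1 hd2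
  refine ⟨I, ∑ u : U, x s(Sum.inl u, Sum.inr 0), ∑ u : U, x s(Sum.inl u, Sum.inr 1),
    ∑ u : U, x s(Sum.inl u, Sum.inr 2), x s(Sum.inr 1, Sum.inr 2), by omega, by omega, by omega,
    ⟨fun u v => x s(Sum.inl u, Sum.inl v),
    fun u => x s(Sum.inl u, Sum.inr 0) + x s(Sum.inl u, Sum.inr 1) + x s(Sum.inl u, Sum.inr 2),
    fun u v => congrArg x Sym2.eq_swap, hR, ?_, ?_, hI, ?_⟩, ?_⟩
  · intro u h
    by_contra hn
    have a0 : x s(Sum.inl u, Sum.inr 0) = 0 := not_not.1 (fun h => hn (hC u 0 h))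
    have a1 : x s(Sum.inl u, Sum.inr 1) = 0 := not_not.1 (fun h => hn (hC u 1 h))
    have a2 : x s(Sum.inl u, Sum.inr 2) = 0 := not_not.1 (fun h => hn (hC u 2 h))
    simp [a0, a1, a2] at h
  · intro u
    have := hd (Sum.inl u)
    rw [bmDeg_eq_sum _ x hs, Fintype.sum_sum_type, Fin.sum_univ_three] at this
    simp only [auxB, Sum.elim_inl] at this
    omega
  · simp_rw [Finset.sum_add_distrib]
  · omega

theorem aux_from [Fintype V] (b : V → ℕ) (c₁ c₂ I a₀ a₁ a₂ e : ℕ) (h0 : a₀ ≤ c₁) (h1 : a₁ + e ≤ c₂)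
    (h2 : a₂ + e ≤ c₂)
    (h : HP (fun u v : U => G.Adj u v) (fun u => (u : V) ∈ C) (fun u => b u) I (a₀ + a₁ + a₂)) :
    ∃ x : Sym2 (U ⊕ Fin 3) → ℕ, IsBMatching (auxGraph G U C) (auxB U b c₁ c₂) x ∧
      bmCard (auxGraph G U C) x = I + (a₀ + a₁ + a₂) + e := by
  obtain ⟨m, r, m1, m2, m3, m4, m5, m6⟩ := h
  obtain ⟨t, ht1, ht2⟩ := transport _ r ![a₀, a₁, a₂] m6 (by simp [Fin.sum_univ_three])
  have hle : ∀ v i, t v i ≤ r v := by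
    intro v i
    rw [← ht1 v]
    exact Finset.single_le_sum (f := fun i => t v i) (fun _ _ => Nat.zero_le _)
      (Finset.mem_univ i)
  have hC : ∀ v i, t v i ≠ 0 → (v : V) ∈ C := by
    intro v i hv
    apply m3
    have := hle v i
    omega
  have s0 := ht2 0
  have s1 := ht2 1
  have s2 := ht2 2
  simp at s0 s1 s2
  obtain ⟨x, hx, hd, hc⟩ := exists_of_matrix (auxGraph G U C)
    (fun a c => match a, c with
      | Sum.inl u, Sum.inl v => m u v
      | Sum.inl u, Sum.inr i => t u i
      | Sum.inr i, Sum.inl u => t u i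
      | Sum.inr i, Sum.inr j => if (i = 1 ∧ j = 2) ∨ (i = 2 ∧ j = 1) then e else 0)
    (by
      rintro (u | i) (v | j)
      · exact m1 u v
      · rfl
      · rfl
      · simp only
        congr 1
        simp only [eq_iff_iff]
        tauto)
    (by
      rintro (u | i) (v | j) <;> intro h
      · exact (aux_ll G U C u v).2 (m2 u v h)
      · exact (aux_lr G U C u j).2 (hC u j h)
      · exact ((aux_lr G U C v i).2 (hC v i h)).symm
      · rw [aux_rr]
        by_contra hn
        simp [hn] at h)
  refine ⟨x, ⟨hx, ?_⟩, ?_⟩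
  · rintro (u | i)
    · rw [hd, Fintype.sum_sum_type]
      have := m4 u
      simp only [auxB, Sum.elim_inl]
      rw [ht1]
      exact this
    · rw [hd, Fintype.sum_sum_type, Fin.sum_univ_three]
      fin_cases i
      · simp [auxB]; omega
      · simp [auxB]; omega
      · simp [auxB]; omega
  · simp_rw [Fintype.sum_sum_type, Finset.sum_add_distrib, ht1, Fin.sum_univ_three] at hc
    simp at hc
    omega

end side

theorem exists_sumEquiv {V : Type*} (G : SimpleGraph V) (U W : Set V) (h : IsSplit G U W) :
    ∃ φ : U ⊕ W ≃ V, (∀ u : U, φ (Sum.inl u) = u) ∧ ∀ u : W, φ (Sum.inr u) = u := by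
  refine ⟨Equiv.ofBijective (Sum.elim (fun u : U => (u : V)) (fun u : W => (u : V))) ⟨?_, ?_⟩,
    fun _ => rfl, fun _ => rfl⟩
  · rintro (u | u) (v | v) e
    · exact congrArg Sum.inl (Subtype.ext e)
    · exact absurd v.2 (Set.disjoint_left.1 h.2.1 ((show (u : V) = v from e) ▸ u.2))
    · exact absurd u.2 (Set.disjoint_left.1 h.2.1 ((show (u : V) = v from e) ▸ v.2))
    · exact congrArg Sum.inr (Subtype.ext e)
  · intro v
    have : v ∈ U ∪ W := by rw [h.1]; trivial
    rcases this with hv | hv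
    · exact ⟨Sum.inl ⟨v, hv⟩, rfl⟩
    · exact ⟨Sum.inr ⟨v, hv⟩, rfl⟩

theorem split_to {V : Type*} [Fintype V] (G : SimpleGraph V) (b : V → ℕ) (U W : Set V)
    (hsplit : IsSplit G U W) (x : Sym2 V → ℕ) (hx : IsBMatching G b x) :
    ∃ I J k, HP (fun u v : U => G.Adj u v) (fun u => (u : V) ∈ splitC G U W) (fun u => b u) I k ∧
      HP (fun u v : W => G.Adj u v) (fun u => (u : V) ∈ splitC G W U) (fun u => b u) J k ∧
      bmCard G x = I + J + k := by
  obtain ⟨hs, hd⟩ := hx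
  have hadj : ∀ u v, x s(u, v) ≠ 0 → G.Adj u v := by
    intro u v h
    by_contra h1
    exact h (hs _ h1)
  have hsp : ∀ f : V → ℕ, ∑ v, f v = ∑ v : U, f v + ∑ v : W, f v := by
    intro f
    obtain ⟨φ, h1, h2⟩ := exists_sumEquiv G U W hsplit
    rw [← Equiv.sum_comp φ, Fintype.sum_sum_type]
    simp_rw [h1, h2]
  obtain ⟨I, hI⟩ := even_matrix (fun u v : U => x s(↑u, ↑v))
    (fun u v => by rw [Sym2.eq_swap]) (fun u v h e => G.ne_of_adj (hadj u v h) (by rw [e]))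
  obtain ⟨J, hJ⟩ := even_matrix (fun u v : W => x s(↑u, ↑v))
    (fun u v => by rw [Sym2.eq_swap]) (fun u v h e => G.ne_of_adj (hadj u v h) (by rw [e]))
  have hk : ∑ v : W, ∑ u : U, x s(↑v, ↑u) = ∑ u : U, ∑ v : W, x s(↑u, ↑v) := by
    rw [Finset.sum_comm]
    refine Finset.sum_congr rfl fun u _ => Finset.sum_congr rfl fun v _ => ?_
    rw [Sym2.eq_swap]
  refine ⟨I, J, ∑ u : U, ∑ v : W, x s(↑u, ↑v),
    ⟨fun u v => x s(↑u, ↑v), fun u => ∑ v : W, x s(↑u, ↑v),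
      fun u v => congrArg x Sym2.eq_swap, fun u v => hadj u v, ?_, ?_, hI, rfl⟩,
    ⟨fun u v => x s(↑u, ↑v), fun v => ∑ u : U, x s(↑v, ↑u),
      fun u v => congrArg x Sym2.eq_swap, fun u v => hadj u v, ?_, ?_, hJ, hk⟩, ?_⟩
  · intro u h
    obtain ⟨v, -, hv⟩ := Finset.exists_ne_zero_of_sum_ne_zero h
    exact ⟨u.2, v, v.2, hadj _ _ hv⟩
  · intro u
    have := hd u
    rwa [bmDeg_eq_sum _ x hs, hsp] at this
  · intro u h
    obtain ⟨v, -, hv⟩ := Finset.exists_ne_zero_of_sum_ne_zero h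
    exact ⟨u.2, v, v.2, hadj _ _ hv⟩
  · intro u
    have := hd u
    rw [bmDeg_eq_sum _ x hs, hsp] at this
    rw [add_comm]
    exact this
  · have hsum := sum_bmDeg G x
    simp_rw [bmDeg_eq_sum _ x hs, hsp, Finset.sum_add_distrib] at hsum
    rw [hk] at hsum
    omega

theorem split_from {V : Type*} [Fintype V] (G : SimpleGraph V) (b : V → ℕ) (U W : Set V)
    (hsplit : IsSplit G U W) (I J k : ℕ)
    (h1 : HP (fun u v : U => G.Adj u v) (fun u => (u : V) ∈ splitC G U W) (fun u => b u) I k)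
    (h2 : HP (fun u v : W => G.Adj u v) (fun u => (u : V) ∈ splitC G W U)
      (fun u => b u) J k) :
    ∃ x, IsBMatching G b x ∧ bmCard G x = I + J + k := by
  obtain ⟨m, r, m1, m2, m3, m4, m5, m6⟩ := h1
  obtain ⟨m', r', n1, n2, n3, n4, n5, n6⟩ := h2
  obtain ⟨t, ht1, ht2⟩ := transport k r r' m6 n6
  have hadj : ∀ u v, t u v ≠ 0 → G.Adj (u : V) (v : V) := by
    intro u v h
    have hr : t u v ≤ r u := by
      rw [← ht1 u]
      exact Finset.single_le_sum (f := fun v => t u v) (fun _ _ => Nat.zero_le _)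
        (Finset.mem_univ v)
    have hr' : t u v ≤ r' v := by
      rw [← ht2 v]
      exact Finset.single_le_sum (f := fun u => t u v) (fun _ _ => Nat.zero_le _)
        (Finset.mem_univ u)
    obtain ⟨-, c, hc, hc'⟩ := m3 u (by omega)
    obtain ⟨-, d, hd, hd'⟩ := n3 v (by omega)
    exact hsplit.2.2.2.2 u u.2 v v.2 ⟨c, hc, hc'⟩ ⟨d, hd, hd'.symm⟩
  obtain ⟨φ, hφ1, hφ2⟩ := exists_sumEquiv G U W hsplit
  let M : U ⊕ W → U ⊕ W → ℕ := fun a c => match a, c with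
      | Sum.inl u, Sum.inl v => m u v
      | Sum.inl u, Sum.inr v => t u v
      | Sum.inr v, Sum.inl u => t u v
      | Sum.inr u, Sum.inr v => m' u v
  have hMs : ∀ a c, M a c = M c a := by
    rintro (u | u) (v | v)
    · exact m1 u v
    · rfl
    · rfl
    · exact n1 u v
  have hMa : ∀ a c, M a c ≠ 0 → G.Adj (φ a) (φ c) := by
    rintro (u | u) (v | v) h <;> simp only [hφ1, hφ2]
    · exact m2 u v h
    · exact hadj u v h
    · exact (hadj v u h).symm
    · exact n2 u v h
  obtain ⟨x, hx, hd, hc⟩ := exists_of_matrix G (fun u v => M (φ.symm u) (φ.symm v))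
    (fun u v => hMs _ _) (fun u v h => by simpa using hMa _ _ h)
  have hrow : ∀ v, ∑ u, M (φ.symm v) (φ.symm u) = ∑ a, M (φ.symm v) a := fun v =>
    Equiv.sum_comp φ.symm (fun a => M (φ.symm v) a)
  refine ⟨x, ⟨hx, ?_⟩, ?_⟩
  · intro v
    rw [hd, hrow]
    obtain ⟨a, rfl⟩ := φ.surjective v
    rw [Equiv.symm_apply_apply, Fintype.sum_sum_type]
    rcases a with u | u
    · rw [hφ1]
      have := m4 u
      rw [← ht1] at this
      exact this
    · rw [hφ2]
      have := n4 u
      rw [← ht2, add_comm] at this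
      exact this
  · simp_rw [hrow] at hc
    rw [Equiv.sum_comp φ.symm (fun c => ∑ a, M c a)] at hc
    simp_rw [Fintype.sum_sum_type, Finset.sum_add_distrib] at hc
    have e1 : ∑ u : U, ∑ v : W, M (Sum.inl u) (Sum.inr v) = k := by
      rw [← m6]
      exact Finset.sum_congr rfl (fun u _ => ht1 u)
    have e2 : ∑ v : W, ∑ u : U, M (Sum.inr v) (Sum.inl u) = k := by
      rw [← n6]
      exact Finset.sum_congr rfl (fun u _ => ht2 u)
    have e3 : ∑ u : U, ∑ v : U, M (Sum.inl u) (Sum.inl v) = 2 * I := m5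
    have e4 : ∑ u : W, ∑ v : W, M (Sum.inr u) (Sum.inr v) = 2 * J := n5
    omega

theorem mu_update {A : Type*} [Fintype A] (G : SimpleGraph A) (b : A → ℕ) (w : A) (t : ℕ) :
    ∃ B : A → ℕ, B w = t ∧ (∀ v, v ≠ w → B v = b v) ∧ mu G b w t = maxBM G B :=
  ⟨Function.update b w t, Function.update_self .., fun _ hv => Function.update_of_ne hv .., rfl⟩

theorem muU_spec {V : Type*} [Fintype V] (G : SimpleGraph V) (b : V → ℕ) (U W : Set V) (t : ℕ) :
    (∃ I k, k ≤ t ∧ HP (fun u v : U => G.Adj u v) (fun u => (u : V) ∈ splitC G U W)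
      (fun u => b u) I k ∧ muU G b U W t = I + k) ∧
    ∀ I k, k ≤ t → HP (fun u v : U => G.Adj u v) (fun u => (u : V) ∈ splitC G U W)
      (fun u => b u) I k → I + k ≤ muU G b U W t := by
  obtain ⟨B, hB0, hB, hmu⟩ : ∃ B : Option U → ℕ, B none = t ∧ (∀ u : U, B (some u) = b u) ∧
      muU G b U W t = maxBM (sideGraph G U (splitC G U W)) B := by
    obtain ⟨B, h1, h2, h3⟩ := mu_update (sideGraph G U (splitC G U W))
      (fun a => a.elim 0 (fun v : U => b ↑v)) none t
    exact ⟨B, h1, fun u => h2 (some u) (by simp), h3⟩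
  rw [hmu]
  obtain ⟨⟨x, hx, hxc⟩, hmax⟩ := maxBM_spec (sideGraph G U (splitC G U W)) B
  constructor
  · obtain ⟨I, k, hk, h, hc⟩ := side_to G U _ b t B hB0 hB x hx
    exact ⟨I, k, hk, h, hxc.symm.trans hc⟩
  · intro I k hk h
    obtain ⟨y, hy, hyc⟩ := side_from G U _ b t I k hk B hB0 hB h
    rw [← hyc]
    exact hmax y hy

theorem muU_step {V : Type*} [Fintype V] (G : SimpleGraph V) (b : V → ℕ) (U W : Set V) (t : ℕ) :
    muU G b U W (t + 1) ≤ muU G b U W t + 1 := by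
  obtain ⟨⟨I, k, hk, h, hc⟩, -⟩ := muU_spec G b U W (t + 1)
  obtain ⟨-, hmax⟩ := muU_spec G b U W t
  by_cases hkt : k ≤ t
  · have := hmax I k hkt h
    omega
  · have := hmax I t le_rfl (h.mono (by omega))
    omega

/-- If `x` is a maximum-cardinality `b`-matching of `(G, b)` and `x^W` is a
maximum-cardinality `b`-matching of `(H_W, b^W)`, then
`‖x‖₁ = ‖x^W‖₁ + μ^U(0) − c₂^U`. -/
theorem max_bmatching_eq_aux {V : Type*} [Fintype V] (G : SimpleGraph V)
    (hG : G.Connected) (b : V → ℕ) (U W : Set V) (hsplit : IsSplit G U W)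
    (tmax c₁ c₂ : ℕ)
    (htmax : ∀ t : ℕ, tmax ≤ t → muU G b U W t = muU G b U W tmax)
    (htmax_least : ∀ t₀ : ℕ,
      (∀ t : ℕ, t₀ ≤ t → muU G b U W t = muU G b U W t₀) → tmax ≤ t₀)
    (hc₁ : muU G b U W c₁ = muU G b U W 0 + c₁)
    (hc₁_max : ∀ t : ℕ, muU G b U W t = muU G b U W 0 + t → t ≤ c₁)
    (hc₂ : c₂ = (tmax - c₁) / 2)
    (x : Sym2 V → ℕ) (hx : IsBMatching G b x)
    (hxmax : ∀ y : Sym2 V → ℕ, IsBMatching G b y → bmCard G y ≤ bmCard G x)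
    (xW : Sym2 (↥W ⊕ Fin 3) → ℕ)
    (hxW : IsBMatching (auxGraph G W (splitC G W U)) (auxB W b c₁ c₂) xW)
    (hxWmax : ∀ yW : Sym2 (↥W ⊕ Fin 3) → ℕ,
      IsBMatching (auxGraph G W (splitC G W U)) (auxB W b c₁ c₂) yW →
      bmCard (auxGraph G W (splitC G W U)) yW ≤
        bmCard (auxGraph G W (splitC G W U)) xW) :
    (bmCard G x : ℤ) =
      (bmCard (auxGraph G W (splitC G W U)) xW : ℤ) + (muU G b U W 0 : ℤ) -
        (c₂ : ℤ) := by
  obtain ⟨htm, hp1, hp2⟩ := pattern (muU G b U W) (mu_mono _ _ _) (muU_step G b U W)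
    (mu_A _ _ _ (muU_step G b U W)) (mu_B _ _ _ (muU_step G b U W)) tmax c₁ c₂ htmax
    htmax_least hc₁ hc₁_max hc₂
  apply le_antisymm
  · obtain ⟨I, J, k, h1, h2, hc⟩ := split_to G b U W hsplit x hx
    -- cap the cut at `tmax`
    obtain ⟨k', hk', hle, hv⟩ : ∃ k', k' ≤ tmax ∧ k' ≤ k ∧ I + k ≤ muU G b U W k' := by
      have hI := (muU_spec G b U W k).2 I k le_rfl h1
      by_cases h : k ≤ tmax
      · exact ⟨k, h, le_rfl, by omega⟩
      · refine ⟨tmax, le_rfl, by omega, ?_⟩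
        rw [htmax k (by omega)] at hI
        omega
    have h2' := h2.mono hle
    by_cases hk1 : k' ≤ c₁
    · obtain ⟨y, hy, hyc⟩ := aux_from G W (splitC G W U) b c₁ c₂ J k' 0 0 c₂ hk1 (by omega)
        (by omega) h2'
      have := hxWmax y hy
      have := hp1 k' hk1
      have hI := (muU_spec G b U W k').2 I k' le_rfl (h1.mono hle)
      omega
    · obtain ⟨j, rfl⟩ : ∃ j, k' = c₁ + j := ⟨k' - c₁, by omega⟩
      obtain ⟨y, hy, hyc⟩ := aux_from G W (splitC G W U) b c₁ c₂ J c₁ (j / 2) (j - j / 2)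
        (c₂ - (j - j / 2)) le_rfl (by omega) (by omega)
        (by rwa [show c₁ + j / 2 + (j - j / 2) = c₁ + j by omega])
      have := hxWmax y hy
      have := hp2 j (by omega)
      have hI := (muU_spec G b U W (c₁ + j)).2 I (c₁ + j) le_rfl (h1.mono hle)
      omega
  · obtain ⟨J, a₀, a₁, a₂, e, h0, h1, h2, hJ, hc⟩ := aux_to G W (splitC G W U) b c₁ c₂ xW hxW
    obtain ⟨⟨I, k', hk', hI, hIc⟩, -⟩ := muU_spec G b U W (a₀ + a₁ + a₂)
    obtain ⟨y, hy, hyc⟩ := split_from G b U W hsplit I J k' hI (hJ.mono hk')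
    have := hxmax y hy
    by_cases hk1 : a₀ + a₁ + a₂ ≤ c₁
    · have := hp1 _ hk1
      omega
    · have := hp2 (a₀ + a₁ + a₂ - c₁) (by omega)
      rw [show c₁ + (a₀ + a₁ + a₂ - c₁) = a₀ + a₁ + a₂ by omega] at this
      omega
end

section
/- Let x^W be a maximum-cardinality b-matching of (H_W, b^W) satisfying the symmetry property deg_{x^W}(u₂) = deg_{x^W}(u₃) and the saturation property that deg_{x^W}(u₁) < c₁^U implies deg_{x^W}(u₂) = x^W_{{u₂,u₃}}. Then u₂ and u₃ are saturated: deg_{x^W}(u₂) = deg_{x^W}(u₃) = c₂^U. -/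
open scoped Classical

/-- Let `x^W` be a maximum-cardinality `b`-matching of `(H_W, b^W)` satisfying
the symmetry property `deg_{x^W}(u₂) = deg_{x^W}(u₃)` and the saturation
property (`deg_{x^W}(u₁) < c₁^U` implies `deg_{x^W}(u₂) = x^W {u₂, u₃}`).
Then `u₂` and `u₃` are saturated: `deg_{x^W}(u₂) = deg_{x^W}(u₃) = c₂^U`.
Here `u₁ = Sum.inr 0`, `u₂ = Sum.inr 1`, `u₃ = Sum.inr 2`. -/
theorem aux_u2_u3_saturated {V : Type*} [Fintype V] (G : SimpleGraph V)
    (hG : G.Connected) (b : V → ℕ) (U W : Set V) (hsplit : IsSplit G U W)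
    (tmax c₁ c₂ : ℕ)
    (htmax : ∀ t : ℕ, tmax ≤ t → muU G b U W t = muU G b U W tmax)
    (htmax_least : ∀ t₀ : ℕ,
      (∀ t : ℕ, t₀ ≤ t → muU G b U W t = muU G b U W t₀) → tmax ≤ t₀)
    (hc₁ : muU G b U W c₁ = muU G b U W 0 + c₁)
    (hc₁_max : ∀ t : ℕ, muU G b U W t = muU G b U W 0 + t → t ≤ c₁)
    (hc₂ : c₂ = (tmax - c₁) / 2)
    (xW : Sym2 (↥W ⊕ Fin 3) → ℕ)
    (hxW : IsBMatching (auxGraph G W (splitC G W U)) (auxB W b c₁ c₂) xW)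
    (hxWmax : ∀ yW : Sym2 (↥W ⊕ Fin 3) → ℕ,
      IsBMatching (auxGraph G W (splitC G W U)) (auxB W b c₁ c₂) yW →
      bmCard (auxGraph G W (splitC G W U)) yW ≤
        bmCard (auxGraph G W (splitC G W U)) xW)
    (hsym : bmDeg (auxGraph G W (splitC G W U)) xW (Sum.inr 1) =
      bmDeg (auxGraph G W (splitC G W U)) xW (Sum.inr 2))
    (hsat : bmDeg (auxGraph G W (splitC G W U)) xW (Sum.inr 0) < c₁ →
      bmDeg (auxGraph G W (splitC G W U)) xW (Sum.inr 1) =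
        xW s(Sum.inr 1, Sum.inr 2)) :
    bmDeg (auxGraph G W (splitC G W U)) xW (Sum.inr 1) = c₂ ∧
    bmDeg (auxGraph G W (splitC G W U)) xW (Sum.inr 2) = c₂ := by
  have key : ¬ bmDeg (auxGraph G W (splitC G W U)) xW (Sum.inr 1) < c₂ := by
    intro hlt
    have he : s(Sum.inr 1, Sum.inr 2) ∈ (auxGraph G W (splitC G W U)).edgeSet := by
      simp [auxGraph]
    generalize auxGraph G W (splitC G W U) = H at *
    have hdeg : ∀ v, bmDeg H (fun e => xW e + if e = s(Sum.inr 1, Sum.inr 2) then 1 else 0) v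
        = bmDeg H xW v + if v = Sum.inr 1 ∨ v = Sum.inr 2 then 1 else 0 := by
      intro v
      unfold bmDeg
      rw [Finset.sum_add_distrib, Finset.sum_ite_eq']
      simp only [Finset.mem_filter, Finset.mem_univ, true_and, he, Sym2.mem_iff]
    have hcard : bmCard H (fun e => xW e + if e = s(Sum.inr 1, Sum.inr 2) then 1 else 0)
        = bmCard H xW + 1 := by
      unfold bmCard
      rw [Finset.sum_add_distrib, Finset.sum_ite_eq']
      simp only [Finset.mem_filter, Finset.mem_univ, true_and, he, if_true]
    have hle := hxWmax (fun e => xW e + if e = s(Sum.inr 1, Sum.inr 2) then 1 else 0) ?_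
    · omega
    · refine ⟨fun e hne => ?_, fun v => ?_⟩
      · have h1 : e ≠ s(Sum.inr 1, Sum.inr 2) := fun h => hne (h ▸ he)
        simp [h1, hxW.1 e hne]
      · rw [hdeg]
        have hv := hxW.2 v
        by_cases h1 : v = Sum.inr 1
        · subst h1
          simp [auxB]
          omega
        · by_cases h2 : v = Sum.inr 2
          · subst h2
            simp [auxB]
            omega
          · simpa [h1, h2] using hv
  have h1 := hxW.2 (Sum.inr 1)
  simp [auxB] at h1
  omega
end

section
/- There exists a maximum-cardinality b-matching x of (H,b) such that for every t with 1 ≤ t ≤ l, both the symmetry property deg_x(u_t²) = deg_x(u_t³) and the saturation property (deg_x(u_t¹) < b(u_t¹) implies deg_x(u_t²) = x_{{u_t²,u_t³}}) hold simultaneously. -/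
open scoped Classical

/-- Shift one unit of weight from the edge `e` to the edge `f`. -/
noncomputable def bmShift {V : Type*} (x : Sym2 V → ℕ) (e f : Sym2 V) : Sym2 V → ℕ :=
  fun g => x g + (if g = f then 1 else 0) - (if g = e then 1 else 0)

theorem bmShift_sum {V : Type*} (x : Sym2 V → ℕ) (e f : Sym2 V) (he : 1 ≤ x e)
    (c : Sym2 V → ℕ) (S : Finset (Sym2 V)) :
    ∑ g ∈ S, c g * bmShift x e f g + (if e ∈ S then c e else 0)
      = ∑ g ∈ S, c g * x g + (if f ∈ S then c f else 0) := by
  have h1 : ∀ a : Sym2 V, (if a ∈ S then c a else 0)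
      = ∑ g ∈ S, c g * (if g = a then 1 else 0) := by
    intro a
    simp
  rw [h1, h1, ← Finset.sum_add_distrib, ← Finset.sum_add_distrib]
  refine Finset.sum_congr rfl fun g _ => ?_
  rw [← mul_add, ← mul_add]
  congr 1
  unfold bmShift
  by_cases hg : g = e
  · subst hg
    simp only [if_true]
    omega
  · simp [hg]

theorem bmDeg_shift {V : Type*} [Fintype V] (G : SimpleGraph V) (x : Sym2 V → ℕ)
    (e f : Sym2 V) (he : 1 ≤ x e) (heE : e ∈ G.edgeSet) (hfE : f ∈ G.edgeSet) (v : V) :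
    bmDeg G (bmShift x e f) v + (if v ∈ e then 1 else 0)
      = bmDeg G x v + (if v ∈ f then 1 else 0) := by
  have := bmShift_sum x e f he (fun _ => 1)
    (Finset.univ.filter (fun e : Sym2 V => e ∈ G.edgeSet ∧ v ∈ e))
  simpa [bmDeg, heE, hfE] using this

theorem bmDeg_exists {V : Type*} [Fintype V] (G : SimpleGraph V) (x : Sym2 V → ℕ)
    (p q : V) (hpq : G.Adj p q) (h : bmDeg G x p ≠ x s(p, q)) :
    ∃ v, v ≠ q ∧ G.Adj p v ∧ 1 ≤ x s(p, v) := by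
  by_contra! hc
  apply h
  unfold bmDeg
  refine Finset.sum_eq_single_of_mem s(p, q) (by simp [hpq]) ?_
  intro e he hne
  simp only [Finset.mem_filter, Finset.mem_univ, true_and] at he
  obtain ⟨he, v, rfl⟩ := he
  have hv : v ≠ q := by
    rintro rfl
    exact hne rfl
  have := hc v hv he
  omega

theorem le_bmDeg {V : Type*} [Fintype V] (G : SimpleGraph V) (x : Sym2 V → ℕ)
    (e : Sym2 V) (p : V) (he : e ∈ G.edgeSet) (hp : p ∈ e) : x e ≤ bmDeg G x p := by
  unfold bmDeg
  exact Finset.single_le_sum (f := x) (fun _ _ => Nat.zero_le _) (by simp [he, hp])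

theorem bMatching_finite {V : Type*} [Fintype V] (G : SimpleGraph V) (b : V → ℕ) :
    {x | IsBMatching G b x}.Finite := by
  refine (Set.finite_Iic (fun _ : Sym2 V => ∑ v, b v)).subset ?_
  intro x hx e
  by_cases he : e ∈ G.edgeSet
  · induction e with
    | h p q =>
      calc x s(p, q) ≤ bmDeg G x p := le_bmDeg G x _ p he (by simp)
        _ ≤ b p := hx.2 p
        _ ≤ ∑ v, b v := Finset.single_le_sum (f := b) (fun _ _ => Nat.zero_le _) (by simp)
  · rw [hx.1 e he]
    exact Nat.zero_le _

/-- A maximum b-matching which in addition is optimal for a secondary weight `c`. -/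
theorem exists_opt {V : Type*} [Fintype V] (G : SimpleGraph V) (b : V → ℕ)
    (c : Sym2 V → ℕ) :
    ∃ x : Sym2 V → ℕ, IsBMatching G b x ∧
      (∀ y : Sym2 V → ℕ, IsBMatching G b y → bmCard G y ≤ bmCard G x) ∧
      ∀ e f, e ∈ G.edgeSet → f ∈ G.edgeSet → 1 ≤ x e →
        (∀ v ∈ f, v ∉ e → bmDeg G x v < b v) → c f ≤ c e := by
  obtain ⟨x0, hx0, hm0⟩ := Set.exists_max_image {x | IsBMatching G b x} (bmCard G)
    (bMatching_finite G b) ⟨fun _ => 0, by simp [IsBMatching, bmDeg]⟩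
  obtain ⟨x, hx, hm⟩ := Set.exists_max_image
    {x | IsBMatching G b x ∧ bmCard G x0 ≤ bmCard G x}
    (fun x => ∑ e ∈ Finset.univ.filter (fun e : Sym2 V => e ∈ G.edgeSet), c e * x e)
    ((bMatching_finite G b).subset fun x hx => hx.1) ⟨x0, hx0, le_rfl⟩
  refine ⟨x, hx.1, fun y hy => (hm0 y hy).trans hx.2, ?_⟩
  intro e f he hf hxe hv
  have h1 := bmShift_sum x e f hxe c (Finset.univ.filter (fun e : Sym2 V => e ∈ G.edgeSet))
  have h2 := bmShift_sum x e f hxe (fun _ => 1)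
    (Finset.univ.filter (fun e : Sym2 V => e ∈ G.edgeSet))
  simp only [Finset.mem_filter, Finset.mem_univ, true_and, he, hf, if_true, one_mul] at h1 h2
  have h3 := hm (bmShift x e f) ⟨⟨?_, ?_⟩, ?_⟩
  · omega
  · intro g hg
    have hgf : g ≠ f := fun h => hg (h ▸ hf)
    simp [bmShift, hx.1.1 g hg, hgf]
  · intro v
    have h4 := bmDeg_shift G x e f hxe he hf v
    have h5 := hx.1.2 v
    have h6 := hv v
    by_cases hve : v ∈ e <;> by_cases hvf : v ∈ f <;> simp [hve, hvf] at h4 h6 <;> omega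
  · have h7 := hx.2
    unfold bmCard at h7 ⊢
    omega

/-- Let `H` contain pairwise disjoint modules `M_t = {u t 0, u t 1, u t 2}`
(`u t 0 = u_t¹`, `u t 1 = u_t²`, `u t 2 = u_t³`) for `t : Fin l`: the three
vertices of `M_t` have the same neighbours outside `M_t`; inside `M_t`, `u_t²`
and `u_t³` are adjacent while `u_t¹` is adjacent to neither; and
`b(u_t²) = b(u_t³)`. Then there exists a maximum-cardinality `b`-matching `x`
of `(H, b)` such that for every `t` both the symmetry property
`deg_x(u_t²) = deg_x(u_t³)` and the saturation property
(`deg_x(u_t¹) < b(u_t¹)` implies `deg_x(u_t²) = x {u_t², u_t³}`) hold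
simultaneously. -/
theorem exists_max_bmatching_symmetric_saturated {V : Type*} [Fintype V]
    (H : SimpleGraph V) (b : V → ℕ) (l : ℕ) (u : Fin l → Fin 3 → V)
    (hinj : Function.Injective (fun p : Fin l × Fin 3 => u p.1 p.2))
    (hmodule : ∀ t : Fin l, ∀ v : V, (∀ i : Fin 3, v ≠ u t i) →
      ∀ i j : Fin 3, (H.Adj v (u t i) ↔ H.Adj v (u t j)))
    (hadj : ∀ t : Fin l, H.Adj (u t 1) (u t 2))
    (hnadj1 : ∀ t : Fin l, ¬ H.Adj (u t 0) (u t 1))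
    (hnadj2 : ∀ t : Fin l, ¬ H.Adj (u t 0) (u t 2))
    (hcap : ∀ t : Fin l, b (u t 1) = b (u t 2)) :
    ∃ x : Sym2 V → ℕ, IsBMatching H b x ∧
      (∀ y : Sym2 V → ℕ, IsBMatching H b y → bmCard H y ≤ bmCard H x) ∧
      ∀ t : Fin l,
        bmDeg H x (u t 1) = bmDeg H x (u t 2) ∧
        (bmDeg H x (u t 0) < b (u t 0) →
          bmDeg H x (u t 1) = x s(u t 1, u t 2)) := by
  let g : V → ℕ := fun v => if ∃ t, v = u t 0 then 1 else 0
  let c : Sym2 V → ℕ := fun e => (if ∃ t, e = s(u t 1, u t 2) then 2 else 0)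
    + Sym2.lift ⟨fun v w => g v + g w, fun v w => add_comm _ _⟩ e
  have hu : ∀ t i t' i', u t i = u t' i' → t = t' ∧ i = i' := by
    intro t i t' i' h
    have := @hinj (t, i) (t', i') h
    simpa using this
  obtain ⟨x, hx, hmax, hopt⟩ := exists_opt H b c
  refine ⟨x, hx, hmax, ?_⟩
  intro t
  have hg1 : ∀ v, g v ≤ 1 := by
    intro v
    simp only [g]
    split_ifs <;> omega
  have hg0 : g (u t 0) = 1 := by
    simp only [g]
    exact if_pos ⟨t, rfl⟩
  have hgi : ∀ i, i ≠ 0 → g (u t i) = 0 := by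
    intro i hi
    simp only [g]
    refine if_neg ?_
    rintro ⟨t', h⟩
    exact hi (hu _ _ _ _ h).2
  have hij : ∀ i j : Fin 3, i ≠ 0 → j ≠ 0 → i ≠ j → s(u t i, u t j) = s(u t 1, u t 2) := by
    intro i j hi hj hne
    fin_cases i <;> fin_cases j <;> simp_all [Sym2.eq_swap]
  have hadj' : ∀ i j : Fin 3, i ≠ 0 → j ≠ 0 → i ≠ j → H.Adj (u t i) (u t j) := by
    intro i j hi hj hne
    rw [← SimpleGraph.mem_edgeSet, hij i j hi hj hne]
    exact hadj t
  have hn0 : ∀ i : Fin 3, ¬ H.Adj (u t 0) (u t i) := by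
    intro i
    fin_cases i
    · exact H.loopless.irrefl _
    · exact hnadj1 t
    · exact hnadj2 t
  have hcv : ∀ i j : Fin 3, i ≠ 0 → j ≠ 0 → i ≠ j → ∀ v, v ≠ u t j →
      c s(u t i, v) = g v := by
    intro i j hi hj hne v hv
    have h0 : ¬ ∃ t', s(u t i, v) = s(u t' 1, u t' 2) := by
      rintro ⟨t', h⟩
      rw [Sym2.eq_iff] at h
      rcases h with ⟨h1, h2⟩ | ⟨h1, h2⟩
      · obtain ⟨rfl, rfl⟩ := hu _ _ _ _ h1
        apply hv
        rw [h2]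
        congr 1
        omega
      · obtain ⟨rfl, rfl⟩ := hu _ _ _ _ h1
        apply hv
        rw [h2]
        congr 1
        omega
    simp only [c, if_neg h0, Sym2.lift_mk, hgi i hi, zero_add]
  have hbi : ∀ i : Fin 3, i ≠ 0 → b (u t i) = b (u t 1) := by
    intro i hi
    fin_cases i
    · exact absurd rfl hi
    · rfl
    · exact (hcap t).symm
  have claim1 : ∀ i j : Fin 3, i ≠ 0 → j ≠ 0 → i ≠ j → bmDeg H x (u t 0) < b (u t 0) →
      bmDeg H x (u t i) = x s(u t i, u t j) := by
    intro i j hi hj hne hlt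
    by_contra hcon
    obtain ⟨v, hvj, hiv, hxv⟩ := bmDeg_exists H x _ _ (hadj' i j hi hj hne) hcon
    have hvk : ∀ k, v ≠ u t k := by
      rintro k rfl
      by_cases hk0 : k = 0
      · subst hk0
        exact hn0 i hiv.symm
      · by_cases hki : k = i
        · subst hki
          exact H.loopless.irrefl _ hiv
        · apply hvj
          congr 1
          omega
    have h0v : H.Adj (u t 0) v := ((hmodule t v hvk i 0).1 hiv.symm).symm
    have h := hopt s(u t i, v) s(u t 0, v) hiv h0v hxv (by
      intro w hw hw'
      simp only [Sym2.mem_iff, not_or] at hw hw'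
      rcases hw with rfl | rfl
      · exact hlt
      · exact absurd rfl hw'.2)
    rw [hcv i j hi hj hne v hvj] at h
    simp only [c, Sym2.lift_mk, hg0] at h
    omega
  have claim2 : ∀ i j : Fin 3, i ≠ 0 → j ≠ 0 → i ≠ j →
      bmDeg H x (u t i) ≤ bmDeg H x (u t j) := by
    intro i j hi hj hne
    by_contra! hlt
    have hle := le_bmDeg H x s(u t i, u t j) (u t j) (hadj' i j hi hj hne) (by simp)
    obtain ⟨v, hvj, hiv, hxv⟩ := bmDeg_exists H x _ _ (hadj' i j hi hj hne) (by omega)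
    have hb : b (u t i) = b (u t j) := by
      rw [hbi i hi, hbi j hj]
    have h := hopt s(u t i, v) s(u t i, u t j) hiv (hadj' i j hi hj hne) hxv (by
      intro w hw hw'
      simp only [Sym2.mem_iff, not_or] at hw hw'
      rcases hw with rfl | rfl
      · exact absurd rfl hw'.1
      · have := hx.2 (u t i)
        omega)
    rw [hcv i j hi hj hne v hvj, hij i j hi hj hne] at h
    have h2 : ∃ t', s(u t 1, u t 2) = s(u t' 1, u t' 2) := ⟨t, rfl⟩
    have h3 := hg1 v
    simp only [c, if_pos h2] at h
    omega
  exact ⟨le_antisymm (claim2 1 2 (by decide) (by decide) (by decide))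
    (claim2 2 1 (by decide) (by decide) (by decide)),
    claim1 1 2 (by decide) (by decide) (by decide)⟩
end
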